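/- Fix N_r, N_t ≥ 1, K ≥ 1, σ > 0, a finite nonempty constellation C ⊆ ℂ with a bit labeling b : C → (Fin K → Bool) such that for every i ∈ Fin K both bit classes of C are nonempty. Let H ∈ Matrix (Fin N_r) (Fin N_t) ℂ admit a factorization H = Q·R with Qᴴ·Q = 1 (Q has orthonormal columns) and R ∈ Matrix (Fin N_t) (Fin N_t) ℂ. Then for every y ∈ ℂ^{N_r}, every k ∈ Fin N_t and every i ∈ Fin K, the maximum-likelihood LLR computed from (y, H) in ℂ^{N_r} equals the maximum-likelihood LLR computed from (Qᴴ·y, R) in ℂ^{N_t}: Λ^{ML}_{i,k}(y, H; σ) = Λ^{ML}_{i,k}(Qᴴ·y, R; σ). -/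

import Mathlib

/-- View a plain complex vector as an element of `EuclideanSpace ℂ (Fin n)`
(so that `‖·‖` is the standard Hermitian / ℓ² norm). -/
noncomputable def toE {n : ℕ} (v : Fin n → ℂ) : EuclideanSpace ℂ (Fin n) :=
  (WithLp.equiv 2 (Fin n → ℂ)).symm v

/-- Maximum-likelihood log-likelihood ratio for bit `i` of stream `k`, computed from the
observation `v ∈ ℂ^m` and the matrix `A`:
`Λ^{ML}_{i,k}(v, A; σ) = log (∑_{x ∈ C^{Nt}, b (x k) i = true} exp (-‖v - A x‖²/σ²) /
                           ∑_{x ∈ C^{Nt}, b (x k) i = false} exp (-‖v - A x‖²/σ²))`,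
where the sums range over all vectors `x : Fin Nt → ℂ` with every coordinate in `C`. -/
noncomputable def mlLLR {m Nt K : ℕ} (C : Finset ℂ) (b : ℂ → Fin K → Bool) (σ : ℝ)
    (A : Matrix (Fin m) (Fin Nt) ℂ) (v : Fin m → ℂ) (i : Fin K) (k : Fin Nt) : ℝ :=
  Real.log (
    (∑ x ∈ (Fintype.piFinset fun _ : Fin Nt => C).filter fun x => b (x k) i = true,
        Real.exp (-‖toE v - toE (A.mulVec x)‖ ^ 2 / σ ^ 2)) /
    (∑ x ∈ (Fintype.piFinset fun _ : Fin Nt => C).filter fun x => b (x k) i = false,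
        Real.exp (-‖toE v - toE (A.mulVec x)‖ ^ 2 / σ ^ 2)))

/-- The squared Hermitian norm of a vector is its dot product with its conjugate. -/
theorem norm_toE_sq {n : ℕ} (w : Fin n → ℂ) : ((‖toE w‖ ^ 2 : ℝ) : ℂ) = star w ⬝ᵥ w := by
  rw [EuclideanSpace.norm_sq_eq, Complex.ofReal_sum]
  refine Finset.sum_congr rfl fun j _ => ?_
  simp [toE, Complex.conj_mul']

/-- If `Q` has orthonormal columns, the distance from `y` to `Q z` splits into the distance from
`Qᴴ y` to `z` and the part of `y` orthogonal to the columns of `Q`. -/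
theorem norm_toE_sub_mulVec_sq {m n : ℕ} {Q : Matrix (Fin m) (Fin n) ℂ}
    (hQ : Q.conjTranspose * Q = 1) (y : Fin m → ℂ) (z : Fin n → ℂ) :
    ‖toE y - toE (Q.mulVec z)‖ ^ 2 =
      ‖toE (Q.conjTranspose.mulVec y) - toE z‖ ^ 2 +
        (‖toE y‖ ^ 2 - ‖toE (Q.conjTranspose.mulVec y)‖ ^ 2) := by
  have toE_sub : ∀ {l : ℕ} (u v : Fin l → ℂ), toE u - toE v = toE (u - v) := fun _ _ => rfl
  have hz : Q.conjTranspose.mulVec (Q.mulVec z) = z := by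
    rw [Matrix.mulVec_mulVec, hQ, Matrix.one_mulVec]
  apply Complex.ofReal_injective
  rw [Complex.ofReal_add, Complex.ofReal_sub, toE_sub, toE_sub]
  simp only [norm_toE_sq, star_sub, sub_dotProduct, dotProduct_sub, Matrix.star_mulVec,
    Matrix.conjTranspose_conjTranspose, ← Matrix.dotProduct_mulVec, hz]
  ring

/-- The ML LLR does not change when all squared distances are shifted by a common constant. -/
theorem mlLLR_congr_of_norm_sq_eq_add {m m' n K : ℕ} (C : Finset ℂ) (b : ℂ → Fin K → Bool)
    (σ : ℝ) {A : Matrix (Fin m) (Fin n) ℂ} {B : Matrix (Fin m') (Fin n) ℂ}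
    {v : Fin m → ℂ} {w : Fin m' → ℂ} (c : ℝ)
    (h : ∀ x, ‖toE v - toE (A.mulVec x)‖ ^ 2 = ‖toE w - toE (B.mulVec x)‖ ^ 2 + c)
    (i : Fin K) (k : Fin n) :
    mlLLR C b σ A v i k = mlLLR C b σ B w i k := by
  have key : ∀ x, Real.exp (-‖toE v - toE (A.mulVec x)‖ ^ 2 / σ ^ 2) =
      Real.exp (-c / σ ^ 2) * Real.exp (-‖toE w - toE (B.mulVec x)‖ ^ 2 / σ ^ 2) := by
    intro x
    rw [h, ← Real.exp_add]
    congr 1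
    ring
  simp only [mlLLR, key, ← Finset.mul_sum]
  rw [mul_div_mul_left _ _ (Real.exp_ne_zero _)]

/-- **Invariance of the maximum-likelihood LLR under a QR-type factorization.**
If `H = Q R` with `Qᴴ Q = 1` (orthonormal columns), then for every observation `y`,
stream `k` and bit `i`, the ML LLR computed from `(y, H)` in `ℂ^{Nr}` equals the ML LLR
computed from `(Qᴴ y, R)` in `ℂ^{Nt}`. -/
theorem mlLLR_qr_invariant
    (Nr Nt K : ℕ) (hNr : 1 ≤ Nr) (hNt : 1 ≤ Nt) (hK : 1 ≤ K)
    (σ : ℝ) (hσ : 0 < σ)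
    (C : Finset ℂ) (hC : C.Nonempty)
    (b : ℂ → Fin K → Bool)
    (hb : ∀ i : Fin K, (∃ x ∈ C, b x i = true) ∧ (∃ x ∈ C, b x i = false))
    (H : Matrix (Fin Nr) (Fin Nt) ℂ)
    (Q : Matrix (Fin Nr) (Fin Nt) ℂ) (R : Matrix (Fin Nt) (Fin Nt) ℂ)
    (hH : H = Q * R) (hQ : Q.conjTranspose * Q = 1) :
    ∀ (y : Fin Nr → ℂ) (k : Fin Nt) (i : Fin K),
      mlLLR C b σ H y i k = mlLLR C b σ R (Q.conjTranspose.mulVec y) i k := by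
  intro y k i
  refine mlLLR_congr_of_norm_sq_eq_add C b σ
    (‖toE y‖ ^ 2 - ‖toE (Q.conjTranspose.mulVec y)‖ ^ 2) (fun x => ?_) i k
  rw [hH, ← Matrix.mulVec_mulVec]
  exact norm_toE_sub_mulVec_sq hQ y _
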